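/- Let D be a 3-dicritical semi-complete digraph. Then D does not contain any tournament of the family T_8 as an induced subdigraph, where T_8 is the set of tournaments obtained from the transitive tournament TT8 on eight vertices by reversing exactly one arc. -/

import Mathlib

/-- A (loopless, simple) digraph on vertex type `V`. -/
structure SimpleDigraph (V : Type) where
  Adj : V → V → Prop
  loopless : ∀ v, ¬ Adj v v

namespace SimpleDigraph

/-- A set of arcs (given as a relation) is acyclic if it admits no directed closed walk. -/
def AcyclicRel {V : Type} (A : V → V → Prop) : Prop :=
  ∀ v, ¬ Relation.TransGen A v v

/-- A set of arcs is 2-dicolourable if the vertices can be coloured with two colours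
so that each colour class induces an acyclic subdigraph. -/
def Dicolourable2Rel {V : Type} (A : V → V → Prop) : Prop :=
  ∃ φ : V → Fin 2, ∀ i : Fin 2,
    AcyclicRel (fun a b => A a b ∧ φ a = i ∧ φ b = i)

/-- A digraph is 2-dicolourable if its vertices can be coloured with two colours
so that each colour class induces an acyclic subdigraph. -/
def Dicolourable2 {V : Type} (D : SimpleDigraph V) : Prop :=
  Dicolourable2Rel D.Adj

/-- `(S, A)` describes a subdigraph of `D`: its vertex set is `S` and its arcs
are given by `A`, which must join vertices of `S` and be arcs of `D`. -/
def IsSubdigraphOn {V : Type} (D : SimpleDigraph V) (S : Set V) (A : V → V → Prop) : Prop :=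
  ∀ u v, A u v → u ∈ S ∧ v ∈ S ∧ D.Adj u v

/-- `D` is 3-dicritical: `D` is not 2-dicolourable, but every proper subdigraph of `D`
(one missing a vertex or an arc) is 2-dicolourable. -/
def Dicritical3 {V : Type} (D : SimpleDigraph V) : Prop :=
  ¬ D.Dicolourable2 ∧
    ∀ (S : Set V) (A : V → V → Prop), D.IsSubdigraphOn S A →
      (S ≠ Set.univ ∨ A ≠ D.Adj) → Dicolourable2Rel A

/-- A digraph is semi-complete if any two distinct vertices are joined by at least one arc. -/
def SemiComplete {V : Type} (D : SimpleDigraph V) : Prop :=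
  ∀ u v : V, u ≠ v → D.Adj u v ∨ D.Adj v u

/-- A tournament is a semi-complete digraph with no digon. -/
def IsTournament {V : Type} (D : SimpleDigraph V) : Prop :=
  D.SemiComplete ∧ ∀ u v : V, ¬ (D.Adj u v ∧ D.Adj v u)

/-- Isomorphism of digraphs. -/
def Iso {V W : Type} (D : SimpleDigraph V) (E : SimpleDigraph W) : Prop :=
  ∃ e : V ≃ W, ∀ u v : V, D.Adj u v ↔ E.Adj (e u) (e v)

/-- `D` contains (a copy of) `H` as a subdigraph. -/
def ContainsSub {V W : Type} (D : SimpleDigraph V) (H : SimpleDigraph W) : Prop :=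
  ∃ f : W → V, Function.Injective f ∧ ∀ a b, H.Adj a b → D.Adj (f a) (f b)

/-- `D` contains (a copy of) `H` as an induced subdigraph. -/
def ContainsInduced {V W : Type} (D : SimpleDigraph V) (H : SimpleDigraph W) : Prop :=
  ∃ f : W → V, Function.Injective f ∧ ∀ a b, H.Adj a b ↔ D.Adj (f a) (f b)

end SimpleDigraph

/-- The tournament obtained from the transitive tournament `TT8` (with acyclic ordering
given by the order on `Fin 8`) by reversing the arc `k → l` (where `k < l`). -/
def revTT8 (k l : Fin 8) : SimpleDigraph (Fin 8) :=
  ⟨fun u v => (u < v ∧ ¬ (u = k ∧ v = l)) ∨ (u = l ∧ v = k ∧ k < l), by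
    rintro v (⟨h, -⟩ | ⟨rfl, rfl, h⟩) <;> exact absurd h (lt_irrefl v)⟩

namespace SimpleDigraph

variable {V : Type} {D : SimpleDigraph V}

/-- The arcs of `D` after the arc `x → y` has been replaced by `y → x`. -/
def reversedAdj (D : SimpleDigraph V) (x y a b : V) : Prop :=
  (D.Adj a b ∧ ¬(a = x ∧ b = y)) ∨ (a = y ∧ b = x)

/-- A colouring giving `x` and `y` the colour `true`, all of whose colour classes
stay acyclic once the arc `x → y` has been reversed. -/
structure IsReversalColouring (D : SimpleDigraph V) (x y : V) (c : V → Bool) : Prop where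
  left : c x = true
  right : c y = true
  acyclic : ∀ i, AcyclicRel fun a b => D.reversedAdj x y a b ∧ c a = i ∧ c b = i

/-- `w` closes a directed triangle with the arc `x → y` and has the colour of `x` and `y` in some
reversal colouring of this arc. -/
structure IsWitness (D : SimpleDigraph V) (x y w : V) : Prop where
  adj_left : D.Adj y w
  adj_right : D.Adj w x
  exists_colouring : ∃ c, D.IsReversalColouring x y c ∧ c w = true

theorem Adj.ne {u v : V} (h : D.Adj u v) : u ≠ v := by
  rintro rfl
  exact D.loopless _ h

/-- If adding the pair `(x, y)` to an acyclic relation creates a closed walk, then the relation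
contains a walk from `y` to `x`. -/
theorem AcyclicRel.reflTransGen_of_transGen {R S : V → V → Prop} {x y : V}
    (hS : AcyclicRel S) (hRS : ∀ a b, R a b → S a b ∨ (a = x ∧ b = y)) {v : V}
    (hv : Relation.TransGen R v v) : Relation.ReflTransGen S y x := by
  have key : ∀ a b, Relation.TransGen R a b → Relation.TransGen S a b ∨
      (Relation.ReflTransGen S a x ∧ Relation.ReflTransGen S y b) ∨
      Relation.ReflTransGen S y x := by
    intro a b hab
    induction hab with
    | single h =>
      rcases hRS _ _ h with h | ⟨rfl, rfl⟩
      · exact Or.inl (.single h)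
      · exact Or.inr (Or.inl ⟨.refl, .refl⟩)
    | tail _ h ih =>
      rcases hRS _ _ h with h | ⟨rfl, rfl⟩
      · rcases ih with ih | ⟨h₁, h₂⟩ | ih
        · exact Or.inl (ih.tail h)
        · exact Or.inr (Or.inl ⟨h₁, h₂.tail h⟩)
        · exact Or.inr (Or.inr ih)
      · rcases ih with ih | ⟨-, h₂⟩ | ih
        · exact Or.inr (Or.inl ⟨ih.to_reflTransGen, .refl⟩)
        · exact Or.inr (Or.inr h₂)
        · exact Or.inr (Or.inr ih)
  rcases key v v hv with h | ⟨h₁, h₂⟩ | h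
  · exact absurd h (hS v)
  · exact h₂.trans h₁
  · exact h

/-- Deleting an arc `x → y` of a 3-dicritical digraph leaves a 2-dicolouring in which `x` and `y`
receive the same colour and this colour class contains a walk from `y` to `x`. -/
theorem Dicritical3.exists_colouring_delete (hD : D.Dicritical3) {x y : V} (hxy : D.Adj x y) :
    ∃ c : V → Bool, c x = true ∧ c y = true ∧
      (∀ i, AcyclicRel fun a b => (D.Adj a b ∧ ¬(a = x ∧ b = y)) ∧ c a = i ∧ c b = i) ∧
      Relation.ReflTransGen
        (fun a b => (D.Adj a b ∧ ¬(a = x ∧ b = y)) ∧ c a = true ∧ c b = true) y x := by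
  obtain ⟨φ, hφ⟩ := hD.2 Set.univ (fun a b => D.Adj a b ∧ ¬(a = x ∧ b = y))
    (fun u v h => ⟨trivial, trivial, h.1⟩)
    (Or.inr fun h => (((congrFun (congrFun h x) y).symm ▸ hxy :
      D.Adj x y ∧ ¬(x = x ∧ y = y))).2 ⟨rfl, rfl⟩)
  have hnot := hD.1
  simp only [Dicolourable2, Dicolourable2Rel, not_exists, not_forall] at hnot
  obtain ⟨i, hi⟩ := hnot φ
  simp only [AcyclicRel, not_forall, not_not] at hi
  obtain ⟨v, hv⟩ := hi
  have hsame : φ x = i ∧ φ y = i := by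
    by_contra hne
    refine hφ i v (hv.lift id fun a b h => ⟨⟨h.1, ?_⟩, h.2⟩)
    rintro ⟨rfl, rfl⟩
    exact hne h.2
  have hpath := (hφ i).reflTransGen_of_transGen (x := x) (y := y)
    (fun a b h =>
      (Classical.em (a = x ∧ b = y)).symm.imp (fun h' => ⟨⟨h.1, h'⟩, h.2⟩) id) hv
  refine ⟨fun v => decide (φ v = i), by simpa using hsame.1, by simpa using hsame.2, ?_, ?_⟩
  · rintro (_ | _) v hv
    · refine hφ (1 - i) v (hv.lift id fun a b h => ⟨h.1, ?_⟩)
      have eq_sub_of_ne : ∀ p q : Fin 2, p ≠ q → p = 1 - q := by decide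
      exact h.2.imp (fun h => eq_sub_of_ne _ _ (by simpa using h))
        (fun h => eq_sub_of_ne _ _ (by simpa using h))
    · exact hφ i v (hv.lift id fun a b h => ⟨h.1, by simpa using h.2⟩)
  · simpa using hpath

/-- A colouring as produced by `Dicritical3.exists_colouring_delete` is a reversal colouring. -/
theorem isReversalColouring_of_delete {x y : V} (hxy : D.Adj x y) {c : V → Bool}
    (hx : c x = true) (hy : c y = true)
    (hc : ∀ i, AcyclicRel fun a b => (D.Adj a b ∧ ¬(a = x ∧ b = y)) ∧ c a = i ∧ c b = i)
    (hp : Relation.ReflTransGen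
      (fun a b => (D.Adj a b ∧ ¬(a = x ∧ b = y)) ∧ c a = true ∧ c b = true) y x) :
    D.IsReversalColouring x y c := by
  refine ⟨hx, hy, ?_⟩
  rintro (_ | _) v hv
  · refine hc false v (hv.lift id ?_)
    rintro a b ⟨h | ⟨rfl, rfl⟩, h'⟩
    · exact ⟨h, h'⟩
    · simp [hx] at h'
  · have hq := (hc true).reflTransGen_of_transGen (x := y) (y := x)
      (fun a b h => h.1.imp (fun h' => ⟨h', h.2⟩) id) hv
    rcases Relation.reflTransGen_iff_eq_or_transGen.1 hp with h | h
    · exact hxy.ne h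
    · exact hc true y (h.trans_left hq)

theorem Dicritical3.exists_isReversalColouring (hD : D.Dicritical3) {x y : V} (hxy : D.Adj x y) :
    ∃ c, D.IsReversalColouring x y c := by
  obtain ⟨c, hx, hy, hc, hp⟩ := hD.exists_colouring_delete hxy
  exact ⟨c, isReversalColouring_of_delete hxy hx hy hc hp⟩

theorem Dicritical3.exists_isWitness (hD : D.Dicritical3) (hsc : D.SemiComplete) {x y : V}
    (hxy : D.Adj x y) (hyx : ¬D.Adj y x) : ∃ w, D.IsWitness x y w := by
  obtain ⟨c, hx, hy, hc, hp⟩ := hD.exists_colouring_delete hxy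
  rcases hp.cases_head with h | ⟨w, hw, hwx⟩
  · exact absurd h.symm hxy.ne
  have hne : w ≠ x := by
    rintro rfl
    exact hyx hw.1.1
  refine ⟨w, hw.1.1, (hsc w x hne).resolve_right fun h => hc true x ?_, c,
    isReversalColouring_of_delete hxy hx hy hc hp, hw.2.2⟩
  exact .head' ⟨⟨h, fun h' => hw.1.1.ne h'.2.symm⟩, hx, hw.2.2⟩ hwx

/-- The endpoints of a reversal colouring force a colour: a monochromatic digon or triangle of the
reversed digraph is impossible. -/
theorem IsReversalColouring.eq_not {x y : V} {c : V → Bool} (hc : D.IsReversalColouring x y c)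
    {p q r : V} {b : Bool} (hp : c p = b) (hq : c q = b) (hrp : D.reversedAdj x y r p)
    (hpq : p = q ∨ D.reversedAdj x y p q) (hqr : D.reversedAdj x y q r) : c r = !b := by
  by_contra hr
  replace hr : c r = b := by
    cases b <;> simpa using hr
  refine hc.acyclic b r ?_
  rcases hpq with rfl | hpq
  · exact .tail (.single ⟨hrp, hr, hp⟩) ⟨hqr, hq, hr⟩
  · exact .tail (.tail (.single ⟨hrp, hr, hp⟩) ⟨hpq, hp, hq⟩) ⟨hqr, hq, hr⟩

/-- A refutation of the existence of some vertices (indexed by `Fin m`) with prescribed arcs.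
A node branches on the direction of an arc; a leaf colours the vertices along a list of forced
moves, for a reversal colouring of some arc, until a vertex would receive both colours. A move
`(p, q, r, b)` gives `r` the colour `!b` because `p` and `q` have colour `b`. -/
inductive Refutation (m : ℕ) where
  | branch (i j : Fin m) (l r : Refutation m)
  | reverse (x y : Fin m) (moves : List (Fin m × Fin m × Fin m × Bool))
  | witness (x y w : Fin m) (moves : List (Fin m × Fin m × Fin m × Bool))

namespace Refutation

variable {m : ℕ}

/-- Check that a list of moves is forced by the arcs `E` and ends with a contradiction. -/
def checkMoves (E : List (Fin m × Fin m)) :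
    List (Fin m × Bool) → List (Fin m × Fin m × Fin m × Bool) → Bool
  | _, [] => false
  | col, (p, q, r, b) :: moves =>
    decide ((p, b) ∈ col ∧ (q, b) ∈ col ∧
        (r, p) ∈ E ∧ (p = q ∨ (p, q) ∈ E) ∧ (q, r) ∈ E) &&
      (decide ((r, b) ∈ col) || checkMoves E ((r, !b) :: col) moves)

/-- Reverse `x → y` in a list of arcs. -/
def reverseArc (arcs : List (Fin m × Fin m)) (x y : Fin m) : List (Fin m × Fin m) :=
  (y, x) :: arcs.filter fun a => a ≠ (x, y)

/-- Check a refutation, given the arcs known so far and a list `W` of triples `(x, y, w)` such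
that `w` is a witness of `x → y`. -/
def check (W : List (Fin m × Fin m × Fin m)) :
    List (Fin m × Fin m) → Refutation m → Bool
  | arcs, branch i j l r =>
    decide (i ≠ j) && check W ((i, j) :: arcs) l && check W ((j, i) :: arcs) r
  | arcs, reverse x y moves =>
    decide ((x, y) ∈ arcs) && checkMoves (reverseArc arcs x y) [(x, true), (y, true)] moves
  | arcs, witness x y w moves =>
    decide ((x, y, w) ∈ W) &&
      checkMoves (reverseArc arcs x y) [(x, true), (y, true), (w, true)] moves

/-- The arcs `(i, j)` with `i < j < k`, together with those between witnesses and their arcs. -/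
def initialArcs (k : ℕ) (W : List (Fin m × Fin m × Fin m)) : List (Fin m × Fin m) :=
  (List.finRange m ×ˢ List.finRange m).filter (fun a => a.1 < a.2 ∧ a.2.val < k) ++
    W.flatMap fun w => [(w.2.1, w.2.2), (w.2.2, w.1)]

variable {f : Fin m → V}

theorem not_checkMoves {x y : V} {c : V → Bool} (hc : D.IsReversalColouring x y c)
    {E : List (Fin m × Fin m)} (hE : ∀ a ∈ E, D.reversedAdj x y (f a.1) (f a.2))
    (moves : List (Fin m × Fin m × Fin m × Bool)) (col : List (Fin m × Bool))
    (hcol : ∀ a ∈ col, c (f a.1) = a.2) : checkMoves E col moves ≠ true := by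
  induction moves generalizing col with
  | nil => simp [checkMoves]
  | cons s moves ih =>
    obtain ⟨p, q, r, b⟩ := s
    intro h
    simp only [checkMoves, Bool.and_eq_true, Bool.or_eq_true, decide_eq_true_eq] at h
    obtain ⟨⟨hp, hq, hrp, hpq, hqr⟩, h⟩ := h
    have hr := hc.eq_not (hcol (p, b) hp) (hcol (q, b) hq) (hE (r, p) hrp)
      (hpq.imp (congrArg f) (hE (p, q))) (hE (q, r) hqr)
    rcases h with h | h
    · simp [hcol _ h] at hr
    · exact ih _ (List.forall_mem_cons.2 ⟨hr, hcol⟩) h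

theorem reversedAdj_of_mem (hf : Function.Injective f) {arcs : List (Fin m × Fin m)}
    (h : ∀ a ∈ arcs, D.Adj (f a.1) (f a.2)) (x y : Fin m) :
    ∀ a ∈ reverseArc arcs x y, D.reversedAdj (f x) (f y) (f a.1) (f a.2) := by
  refine List.forall_mem_cons.2 ⟨Or.inr ⟨rfl, rfl⟩, fun a ha => ?_⟩
  simp only [List.mem_filter, decide_eq_true_eq] at ha
  exact Or.inl ⟨h a ha.1, fun h' => ha.2 (Prod.ext (hf h'.1) (hf h'.2))⟩

theorem not_check (hD : D.Dicritical3) (hsc : D.SemiComplete) (hf : Function.Injective f)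
    {W : List (Fin m × Fin m × Fin m)} (hW : ∀ w ∈ W, D.IsWitness (f w.1) (f w.2.1) (f w.2.2))
    (R : Refutation m) (arcs : List (Fin m × Fin m))
    (harcs : ∀ a ∈ arcs, D.Adj (f a.1) (f a.2)) : check W arcs R ≠ true := by
  induction R generalizing arcs with
  | branch i j l r ihl ihr =>
    intro h
    simp only [check, Bool.and_eq_true, decide_eq_true_eq] at h
    rcases hsc (f i) (f j) (hf.ne h.1.1) with hij | hji
    · exact ihl _ (List.forall_mem_cons.2 ⟨hij, harcs⟩) h.1.2
    · exact ihr _ (List.forall_mem_cons.2 ⟨hji, harcs⟩) h.2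
  | reverse x y moves =>
    intro h
    simp only [check, Bool.and_eq_true, decide_eq_true_eq] at h
    obtain ⟨c, hc⟩ := hD.exists_isReversalColouring (harcs _ h.1)
    exact not_checkMoves hc (reversedAdj_of_mem hf harcs x y) moves _
      (by simp [hc.left, hc.right]) h.2
  | witness x y w moves =>
    intro h
    simp only [check, Bool.and_eq_true, decide_eq_true_eq] at h
    obtain ⟨c, hc, hw⟩ := (hW _ h.1).exists_colouring
    exact not_checkMoves hc (reversedAdj_of_mem hf harcs x y) moves _
      (by simp [hc.left, hc.right, show c (f w) = true from hw]) h.2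

theorem not_check_initialArcs (hD : D.Dicritical3) (hsc : D.SemiComplete)
    (hf : Function.Injective f) {k : ℕ}
    (hT : ∀ i j : Fin m, i < j → j.val < k → D.Adj (f i) (f j))
    {W : List (Fin m × Fin m × Fin m)} (hW : ∀ w ∈ W, D.IsWitness (f w.1) (f w.2.1) (f w.2.2))
    (R : Refutation m) : check W (initialArcs k W) R ≠ true := by
  refine not_check hD hsc hf hW R _ fun a ha => ?_
  simp only [initialArcs, List.mem_append, List.mem_filter, List.mem_flatMap, List.mem_cons,
    List.not_mem_nil, or_false, decide_eq_true_eq] at ha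
  rcases ha with ⟨-, h₁, h₂⟩ | ⟨w, hw, rfl | rfl⟩
  · exact hT _ _ h₁ h₂
  · exact (hW w hw).adj_left
  · exact (hW w hw).adj_right

end Refutation

/-- Refutation for witnesses of the arcs `(1, 2)`, `(2, 3)`, `(3, 4)`, `(4, 5)` when
four distinct witnesses. -/
def refutationDistinct : Refutation 11 :=
  .branch 7 0
    (.branch 8 0
      (.branch 7 3
        (.branch 8 9
          (.branch 7 8
            (.branch 7 4
              (.branch 8 4
                (.reverse 7 4 [(4, 7, 0, true), (4, 7, 3, true), (0, 3, 8, false), (4, 7,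
                  8, true)])
                (.branch 9 0
                  (.witness 2 3 8 [(3, 8, 0, true), (8, 2, 4, true), (0, 4, 9, false), (3,
                    8, 9, true)])
                  (.branch 7 9
                    (.reverse 7 9 [(9, 7, 0, true), (9, 7, 4, true), (0, 4, 8, false), (9,
                      7, 8, true)])
                    (.witness 2 3 8 [(3, 8, 0, true), (3, 2, 7, true), (7, 0, 9, false),
                      (3, 8, 9, true)]))))
              (.reverse 2 5 [(5, 2, 3, true), (5, 2, 4, true), (3, 4, 7, false), (2, 7, 8,
                true), (3, 8, 0, false), (2, 7, 0, true)]))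
            (.branch 8 1
              (.branch 7 4
                (.branch 8 4
                  (.reverse 8 4 [(4, 8, 0, true), (4, 8, 2, true), (0, 2, 7, false), (4,
                    8, 7, true)])
                  (.reverse 0 4 [(4, 0, 1, true), (4, 0, 2, true), (4, 0, 3, true), (1, 2,
                    7, false), (1, 3, 8, false), (7, 4, 8, true)]))
                (.branch 8 4
                  (.branch 7 9
                    (.reverse 8 9 [(9, 8, 4, true), (9, 8, 7, true), (4, 7, 0, false), (4,
                      7, 3, false), (8, 0, 3, true)])
                    (.branch 9 0
                      (.reverse 8 7 [(7, 8, 4, true), (7, 8, 9, true), (4, 9, 0, false),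
                        (4, 9, 3, false), (8, 0, 3, true)])
                      (.witness 2 3 8 [(3, 8, 0, true), (3, 2, 7, true), (7, 0, 9, false),
                        (3, 8, 9, true)])))
                  (.witness 2 3 8 [(3, 8, 0, true), (8, 2, 4, true), (0, 4, 7, false), (3,
                    2, 7, true)])))
              (.reverse 1 4 [(4, 1, 2, true), (4, 1, 3, true), (2, 3, 8, false), (1, 8, 0,
                true), (0, 2, 7, false), (1, 8, 7, true)])))
          (.branch 9 0
            (.branch 9 2
              (.branch 8 4
                (.branch 7 9
                  (.branch 7 8
                    (.branch 7 4
                      (.reverse 7 4 [(4, 7, 0, true), (4, 7, 3, true), (0, 3, 8, false),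
                        (4, 7, 8, true)])
                      (.witness 1 2 7 [(2, 7, 0, true), (7, 1, 4, true), (0, 4, 9, false),
                        (2, 7, 9, true)]))
                    (.reverse 0 5 [(5, 0, 1, true), (5, 0, 2, true), (5, 0, 3, true), (5,
                      0, 4, true), (1, 2, 7, false), (2, 3, 8, false), (2, 4, 9, false),
                      (8, 7, 9, true)]))
                  (.reverse 9 3 [(3, 9, 0, true), (3, 9, 2, true), (0, 2, 7, false), (3,
                    9, 7, true)]))
                (.reverse 9 2 [(2, 9, 0, true), (2, 9, 8, true), (8, 0, 3, false), (8, 0,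
                  4, false), (9, 3, 4, true)]))
              (.reverse 2 5 [(5, 2, 3, true), (5, 2, 4, true), (3, 4, 9, false), (2, 9, 0,
                true), (0, 3, 8, false), (2, 9, 8, true)]))
            (.reverse 0 5 [(5, 0, 2, true), (5, 0, 3, true), (5, 0, 4, true), (2, 3, 8,
              false), (3, 4, 9, false), (8, 0, 9, true)])))
        (.branch 7 8
          (.witness 1 2 7 [(2, 7, 0, true), (7, 1, 3, true), (0, 3, 8, false), (2, 7, 8,
            true)])
          (.branch 8 1
            (.reverse 8 1 [(1, 8, 0, true), (1, 8, 7, true), (7, 0, 2, false), (7, 0, 3,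
              false), (8, 2, 3, true)])
            (.witness 1 2 7 [(2, 7, 0, true), (7, 1, 3, true), (0, 3, 8, false), (2, 1, 8,
              true)]))))
      (.branch 7 8
        (.branch 8 4
          (.reverse 0 4 [(4, 0, 2, true), (4, 0, 3, true), (2, 3, 8, false), (4, 0, 8,
            true)])
          (.branch 8 6
            (.reverse 0 6 [(6, 0, 2, true), (6, 0, 3, true), (2, 3, 8, false), (6, 0, 8,
              true)])
            (.branch 8 5
              (.reverse 0 5 [(5, 0, 2, true), (5, 0, 3, true), (2, 3, 8, false), (5, 0, 8,
                true)])
              (.branch 10 3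
                (.branch 10 2
                  (.branch 8 10
                    (.witness 2 3 8 [(8, 2, 4, true), (8, 2, 5, true), (4, 5, 10, false),
                      (3, 8, 10, true)])
                    (.branch 10 0
                      (.branch 10 6
                        (.branch 10 1
                          (.branch 7 5
                            (.branch 7 10
                              (.reverse 7 8 [(8, 7, 0, true), (8, 7, 5, true), (0, 5, 10,
                                false), (8, 7, 10, true)])
                              (.witness 4 5 10 [(5, 10, 0, true), (5, 10, 2, true), (0, 2,
                                7, false), (5, 10, 7, true)]))
                            (.branch 7 10
                              (.witness 1 2 7 [(2, 7, 0, true), (7, 1, 5, true), (0, 5,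
                                10, false), (2, 7, 10, true)])
                              (.reverse 10 1 [(1, 10, 0, true), (1, 10, 7, true), (7, 0,
                                2, false), (7, 0, 5, false), (10, 2, 5, true)])))
                          (.reverse 1 6 [(6, 1, 2, true), (6, 1, 5, true), (2, 5, 10,
                            false), (6, 1, 10, true)]))
                        (.reverse 5 8 [(8, 5, 6, true), (8, 5, 10, true), (6, 10, 2,
                          false), (6, 10, 3, false), (8, 2, 3, true)]))
                      (.reverse 0 8 [(8, 0, 3, true), (8, 0, 5, true), (3, 5, 10, false),
                        (8, 0, 10, true)])))
                  (.witness 2 3 8 [(8, 2, 4, true), (8, 2, 5, true), (4, 5, 10, false),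
                    (3, 2, 10, true)]))
                (.branch 8 10
                  (.branch 10 0
                    (.reverse 0 6 [(6, 0, 2, true), (6, 0, 3, true), (6, 0, 4, true), (6,
                      0, 5, true), (2, 3, 8, false), (4, 5, 10, false), (0, 8, 10, true)])
                    (.branch 10 2
                      (.reverse 0 4 [(4, 0, 2, true), (4, 0, 3, true), (2, 3, 10, false),
                        (4, 0, 10, true)])
                      (.reverse 0 10 [(10, 0, 2, true), (10, 0, 3, true), (2, 3, 8,
                        false), (10, 0, 8, true)])))
                  (.reverse 3 8 [(8, 3, 4, true), (8, 3, 5, true), (4, 5, 10, false), (8,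
                    3, 10, true)]))))))
        (.reverse 0 4 [(4, 0, 1, true), (4, 0, 2, true), (4, 0, 3, true), (1, 2, 7,
          false), (2, 3, 8, false), (7, 0, 8, true)])))
    (.branch 7 3
      (.reverse 0 3 [(3, 0, 1, true), (3, 0, 2, true), (1, 2, 7, false), (3, 0, 7, true)])
      (.branch 7 4
        (.reverse 0 4 [(4, 0, 1, true), (4, 0, 2, true), (1, 2, 7, false), (4, 0, 7,
          true)])
        (.branch 7 5
          (.reverse 0 5 [(5, 0, 1, true), (5, 0, 2, true), (1, 2, 7, false), (5, 0, 7,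
            true)])
          (.branch 9 0
            (.branch 7 9
              (.reverse 0 5 [(5, 0, 1, true), (5, 0, 2, true), (5, 0, 3, true), (5, 0, 4,
                true), (1, 2, 7, false), (3, 4, 9, false), (0, 7, 9, true)])
              (.branch 7 8
                (.branch 8 4
                  (.reverse 0 4 [(4, 0, 1, true), (4, 0, 2, true), (4, 0, 3, true), (1, 2,
                    7, false), (2, 3, 8, false), (4, 7, 8, true)])
                  (.branch 8 0
                    (.reverse 0 4 [(4, 0, 1, true), (4, 0, 2, true), (4, 0, 3, true), (1,
                      2, 7, false), (2, 3, 8, false), (0, 7, 8, true)])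
                    (.branch 8 1
                      (.witness 2 3 8 [(3, 8, 1, true), (8, 2, 4, true), (1, 4, 7, false),
                        (8, 2, 7, true)])
                      (.reverse 0 8 [(8, 0, 1, true), (8, 0, 3, true), (1, 3, 7, false),
                        (8, 0, 7, true)]))))
                (.branch 8 0
                  (.branch 8 9
                    (.branch 8 4
                      (.reverse 8 7 [(7, 8, 0, true), (7, 8, 4, true), (0, 4, 9, false),
                        (7, 8, 9, true)])
                      (.witness 2 3 8 [(3, 8, 0, true), (8, 2, 4, true), (0, 4, 9, false),
                        (3, 8, 9, true)]))
                    (.reverse 9 7 [(7, 9, 0, true), (7, 9, 3, true), (0, 3, 8, false), (7,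
                      9, 8, true)]))
                  (.reverse 0 7 [(7, 0, 2, true), (7, 0, 3, true), (2, 3, 8, false), (7,
                    0, 8, true)]))))
            (.branch 9 5
              (.reverse 0 5 [(5, 0, 3, true), (5, 0, 4, true), (3, 4, 9, false), (5, 0, 9,
                true)])
              (.branch 7 9
                (.branch 9 1
                  (.witness 3 4 9 [(4, 9, 1, true), (9, 3, 5, true), (1, 5, 7, false), (9,
                    3, 7, true)])
                  (.reverse 0 9 [(9, 0, 1, true), (9, 0, 4, true), (1, 4, 7, false), (9,
                    0, 7, true)]))
                (.reverse 0 7 [(7, 0, 3, true), (7, 0, 4, true), (3, 4, 9, false), (7, 0,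
                  9, true)])))))))

/-- Refutation for witnesses of the arcs `(1, 2)`, `(2, 3)`, `(3, 4)`, `(4, 5)` when
only the first and third witnesses coincide. -/
def refutationFirstEqThird : Refutation 10 :=
  .branch 7 5
    (.reverse 2 5 [(5, 2, 3, true), (5, 2, 4, true), (3, 4, 7, false), (5, 2, 7, true)])
    (.branch 7 0
      (.branch 9 1
        (.branch 9 3
          (.branch 7 9
            (.witness 3 4 7 [(4, 7, 1, true), (7, 3, 5, true), (1, 5, 9, false), (4, 7, 9,
              true)])
            (.reverse 9 3 [(3, 9, 1, true), (3, 9, 7, true), (7, 1, 4, false), (7, 1, 5,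
              false), (9, 4, 5, true)]))
          (.witness 3 4 7 [(4, 7, 1, true), (7, 3, 5, true), (1, 5, 9, false), (4, 3, 9,
            true)]))
        (.branch 7 9
          (.branch 9 3
            (.reverse 0 4 [(4, 0, 1, true), (4, 0, 2, true), (4, 0, 3, true), (1, 2, 7,
              false), (4, 7, 9, true), (9, 3, 5, false), (7, 0, 5, true)])
            (.branch 9 2
              (.witness 1 2 7 [(7, 1, 4, true), (7, 1, 5, true), (4, 5, 9, false), (2, 1,
                9, true)])
              (.reverse 2 9 [(9, 2, 3, true), (9, 2, 5, true), (3, 5, 7, false), (9, 2, 7,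
                true)])))
          (.witness 1 2 7 [(7, 1, 4, true), (7, 1, 5, true), (4, 5, 9, false), (7, 1, 9,
            true)])))
      (.reverse 0 3 [(3, 0, 1, true), (3, 0, 2, true), (1, 2, 7, false), (3, 0, 7, true)]))

/-- Refutation for witnesses of the arcs `(1, 2)`, `(2, 3)`, `(3, 4)`, `(4, 5)` when
only the second and fourth witnesses coincide. -/
def refutationSecondEqFourth : Refutation 10 :=
  .branch 8 6
    (.reverse 3 6 [(6, 3, 4, true), (6, 3, 5, true), (4, 5, 8, false), (6, 3, 8, true)])
    (.branch 8 1
      (.branch 7 4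
        (.branch 7 8
          (.branch 7 3
            (.reverse 7 4 [(4, 7, 1, true), (4, 7, 3, true), (1, 3, 8, false), (4, 7, 8,
              true)])
            (.reverse 2 6 [(6, 2, 3, true), (6, 2, 4, true), (6, 2, 5, true), (4, 5, 8,
              false), (6, 8, 1, true), (1, 3, 7, false), (8, 2, 7, true)]))
          (.reverse 8 4 [(4, 8, 1, true), (4, 8, 2, true), (1, 2, 7, false), (4, 8, 7,
            true)]))
        (.branch 7 5
          (.witness 4 5 8 [(5, 8, 1, true), (5, 8, 2, true), (1, 2, 7, false), (5, 4, 7,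
            true)])
          (.branch 7 3
            (.witness 2 3 8 [(3, 8, 1, true), (8, 2, 5, true), (1, 5, 7, false), (3, 2, 7,
              true)])
            (.branch 7 8
              (.witness 1 2 7 [(7, 1, 4, true), (7, 1, 5, true), (4, 5, 8, false), (2, 7,
                8, true)])
              (.reverse 3 7 [(7, 3, 4, true), (7, 3, 5, true), (4, 5, 8, false), (7, 3, 8,
                true)])))))
      (.reverse 1 4 [(4, 1, 2, true), (4, 1, 3, true), (2, 3, 8, false), (4, 1, 8, true)]))

/-- Refutation for witnesses of the arcs `(1, 2)`, `(2, 3)`, `(3, 4)`, `(4, 5)` when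
only the first and fourth witnesses coincide. -/
def refutationFirstEqFourth : Refutation 10 :=
  .branch 7 6
    (.reverse 2 6 [(6, 2, 4, true), (6, 2, 5, true), (4, 5, 7, false), (6, 2, 7, true)])
    (.branch 7 9
      (.branch 9 2
        (.reverse 2 6 [(6, 2, 3, true), (6, 2, 4, true), (6, 2, 5, true), (4, 5, 7,
          false), (3, 4, 9, false), (2, 7, 9, true)])
        (.branch 9 6
          (.reverse 2 6 [(6, 2, 3, true), (6, 2, 4, true), (3, 4, 9, false), (6, 2, 9,
            true)])
          (.reverse 2 9 [(9, 2, 4, true), (9, 2, 6, true), (4, 6, 7, false), (9, 2, 7,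
            true)])))
      (.branch 9 1
        (.branch 9 2
          (.witness 3 4 9 [(4, 9, 1, true), (4, 9, 2, true), (1, 2, 7, false), (4, 9, 7,
            true)])
          (.reverse 0 4 [(4, 0, 1, true), (4, 0, 2, true), (1, 2, 7, false), (1, 2, 9,
            false), (7, 4, 9, true)]))
        (.reverse 1 6 [(6, 1, 3, true), (6, 1, 4, true), (6, 1, 5, true), (4, 5, 7,
          false), (3, 4, 9, false), (7, 1, 9, true)])))

/-- Refutation for witnesses of the arcs `(1, 2)`, `(2, 3)`, `(3, 4)`, `(4, 5)` when
the first and third witnesses coincide, and so do the second and fourth. -/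
def refutationAlternating : Refutation 9 :=
  .branch 7 5
    (.reverse 2 5 [(5, 2, 3, true), (5, 2, 4, true), (3, 4, 7, false), (5, 2, 7, true)])
    (.branch 8 1
      (.witness 2 3 8 [(3, 8, 1, true), (8, 2, 5, true), (1, 5, 7, false), (3, 2, 7,
        true)])
      (.witness 1 2 7 [(7, 1, 4, true), (7, 1, 5, true), (4, 5, 8, false), (2, 1, 8,
        true)]))

/-- A tuple enumerating a transitive tournament on `Fin k`. -/
def IsTransitive {k : ℕ} (D : SimpleDigraph V) (t : Fin k → V) : Prop :=
  Function.Injective t ∧ ∀ i j, D.Adj (t i) (t j) ↔ i < j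

theorem IsTransitive.witness_ne {k : ℕ} {t : Fin k → V} (ht : D.IsTransitive t) {i j : Fin k}
    (hij : i.val + 1 = j.val) {w : V} (hw : D.IsWitness (t i) (t j) w) (l : Fin k) :
    t l ≠ w := by
  rintro rfl
  have h₁ := (ht.2 _ _).1 hw.adj_left
  have h₂ := (ht.2 _ _).1 hw.adj_right
  omega

theorem IsTransitive.not_check {k n : ℕ} {t : Fin k → V} (ht : D.IsTransitive t)
    (hD : D.Dicritical3) (hsc : D.SemiComplete) {u : Fin n → V} (hu : Function.Injective u)
    (htu : ∀ j i, t i ≠ u j) {W : List (Fin (k + n) × Fin (k + n) × Fin (k + n))}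
    (hW : ∀ w ∈ W, D.IsWitness (Fin.append t u w.1) (Fin.append t u w.2.1)
      (Fin.append t u w.2.2))
    (R : Refutation (k + n)) : R.check W (Refutation.initialArcs k W) ≠ true := by
  refine Refutation.not_check_initialArcs hD hsc
    (Fin.append_injective_iff.2 ⟨ht.1, hu, fun i j => htu j i⟩) (fun i j hij hj => ?_) hW R
  obtain ⟨i, rfl⟩ : ∃ i', i = Fin.castAdd n i' := ⟨⟨i, by omega⟩, rfl⟩
  obtain ⟨j, rfl⟩ : ∃ j', j = Fin.castAdd n j' := ⟨⟨j, hj⟩, rfl⟩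
  simp only [Fin.append_left, ht.2]
  exact hij

theorem Dicritical3.not_isTransitive (hD : D.Dicritical3) (hsc : D.SemiComplete)
    (t : Fin 7 → V) : ¬D.IsTransitive t := by
  intro ht
  have exists_witness : ∀ i j : Fin 7, i < j → ∃ w, D.IsWitness (t i) (t j) w :=
    fun i j hij => hD.exists_isWitness hsc ((ht.2 _ _).2 hij) fun h => lt_asymm hij ((ht.2 _ _).1 h)
  obtain ⟨a, ha⟩ := exists_witness 1 2 (by decide)
  obtain ⟨b, hb⟩ := exists_witness 2 3 (by decide)
  obtain ⟨c, hc⟩ := exists_witness 3 4 (by decide)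
  obtain ⟨d, hd⟩ := exists_witness 4 5 (by decide)
  have hta := ht.witness_ne (by decide) ha
  have htb := ht.witness_ne (by decide) hb
  have htc := ht.witness_ne (by decide) hc
  have htd := ht.witness_ne (by decide) hd
  have hab : a ≠ b := by
    rintro rfl
    refine ht.not_check hD hsc (u := ![a]) (Function.injective_of_subsingleton _)
      (fun _ => by simpa using hta) (W := [(1, 2, 7), (2, 3, 7)]) ?_
      (.witness 1 2 7 [(7, 7, 2, true)]) (by decide +kernel)
    simpa using ⟨ha, hb⟩
  have hbc : b ≠ c := by
    rintro rfl
    refine ht.not_check hD hsc (u := ![b]) (Function.injective_of_subsingleton _)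
      (fun _ => by simpa using htb) (W := [(2, 3, 7), (3, 4, 7)]) ?_
      (.witness 2 3 7 [(7, 7, 3, true)]) (by decide +kernel)
    simpa using ⟨hb, hc⟩
  have hcd : c ≠ d := by
    rintro rfl
    refine ht.not_check hD hsc (u := ![c]) (Function.injective_of_subsingleton _)
      (fun _ => by simpa using htc) (W := [(3, 4, 7), (4, 5, 7)]) ?_
      (.witness 3 4 7 [(7, 7, 4, true)]) (by decide +kernel)
    simpa using ⟨hc, hd⟩
  rcases eq_or_ne a c with rfl | hac
  · rcases eq_or_ne b d with rfl | hbd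
    · refine ht.not_check hD hsc (u := ![a, b]) ?_ ?_
        (W := [(1, 2, 7), (2, 3, 8), (3, 4, 7), (4, 5, 8)]) ?_
        refutationAlternating (by decide +kernel)
      · simp [Function.Injective, Fin.forall_fin_succ, *, Ne.symm]
      · intro j
        fin_cases j
        exacts [hta, htb]
      · simpa using ⟨ha, hb, hc, hd⟩
    · refine ht.not_check hD hsc (u := ![a, b, d]) ?_ ?_
        (W := [(1, 2, 7), (2, 3, 8), (3, 4, 7), (4, 5, 9)]) ?_
        refutationFirstEqThird (by decide +kernel)
      · simp [Function.Injective, Fin.forall_fin_succ, *, Ne.symm]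
      · intro j
        fin_cases j
        exacts [hta, htb, htd]
      · simpa using ⟨ha, hb, hc, hd⟩
  rcases eq_or_ne b d with rfl | hbd
  · refine ht.not_check hD hsc (u := ![a, b, c]) ?_ ?_
      (W := [(1, 2, 7), (2, 3, 8), (3, 4, 9), (4, 5, 8)]) ?_
      refutationSecondEqFourth (by decide +kernel)
    · simp [Function.Injective, Fin.forall_fin_succ, *, Ne.symm]
    · intro j
      fin_cases j
      exacts [hta, htb, htc]
    · simpa using ⟨ha, hb, hc, hd⟩
  rcases eq_or_ne a d with rfl | had
  · refine ht.not_check hD hsc (u := ![a, b, c]) ?_ ?_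
      (W := [(1, 2, 7), (2, 3, 8), (3, 4, 9), (4, 5, 7)]) ?_
      refutationFirstEqFourth (by decide +kernel)
    · simp [Function.Injective, Fin.forall_fin_succ, *, Ne.symm]
    · intro j
      fin_cases j
      exacts [hta, htb, htc]
    · simpa using ⟨ha, hb, hc, hd⟩
  refine ht.not_check hD hsc (u := ![a, b, c, d]) ?_ ?_
    (W := [(1, 2, 7), (2, 3, 8), (3, 4, 9), (4, 5, 10)]) ?_
    refutationDistinct (by decide +kernel)
  · simp [Function.Injective, Fin.forall_fin_succ, *, Ne.symm]
  · intro j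
    fin_cases j
    exacts [hta, htb, htc, htd]
  · simpa using ⟨ha, hb, hc, hd⟩

end SimpleDigraph

/-- A 3-dicritical semi-complete digraph does not contain any tournament
obtained from `TT8` by reversing exactly one arc as an induced subdigraph. -/
theorem dicritical3_revTT8_induced_free
    {V : Type} [Fintype V] (D : SimpleDigraph V) (hD : D.Dicritical3)
    (hsc : D.SemiComplete) :
    ∀ k l : Fin 8, k < l → ¬ D.ContainsInduced (revTT8 k l) := by
  rintro k l - ⟨f, hf, h⟩
  refine hD.not_isTransitive hsc (f ∘ k.succAbove)
    ⟨hf.comp Fin.succAbove_right_injective, fun i j => ?_⟩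
  simp [← h, revTT8, Fin.succAbove_ne]
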